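/- Let p > 1, α > 0, R > 0 and let Ω = B_R(0) ⊂ ℝ^N be the open ball of radius R centered at the origin. Let f satisfy condition (C) with s ↦ f(s)^{−1/(p−1)} integrable on (0, a) for every a ∈ (0, a_f), and assume ‖F‖_∞ := ∫₀^{a_f} f(s)^{−1/(p−1)} ds < ∞. If λ > (((α+p)/(p−1))·‖F‖_∞)^{p−1}·(α+N)·R^{−(α+p)}, then there is no function u : cl(B_R(0)) → ℝ that is continuous on cl(B_R(0)), C¹ on B_R(0) with 0 < u(x) < a_f for x ∈ B_R(0) and u = 0 on the sphere ‖x‖ = R, whose flux V_u is continuously differentiable on B_R(0) with div V_u(x) ≤ −λ·‖x‖^α·f(u(x)) for all x ∈ B_R(0). -/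

import Mathlib

open Real Set Metric MeasureTheory

/-- The "flux" of `u` at `x`: `‖∇u(x)‖^(p-2) ∇u(x)` (equal to `0` when `∇u(x) = 0`,
by the junk-value conventions of `Real.rpow`, since `p ≠ 2` gives `0 ^ (p-2) = 0` and
for `p = 2` the scalar multiplies the zero vector). -/
noncomputable def flux {N : ℕ} (p : ℝ) (u : EuclideanSpace ℝ (Fin N) → ℝ)
    (x : EuclideanSpace ℝ (Fin N)) : EuclideanSpace ℝ (Fin N) :=
  ‖gradient u x‖ ^ (p - 2) • gradient u x

/-- The divergence of a vector field `V` at `x`: `∑ i, ∂V_i/∂x_i (x)`. -/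
noncomputable def pdiv {N : ℕ} (V : EuclideanSpace ℝ (Fin N) → EuclideanSpace ℝ (Fin N))
    (x : EuclideanSpace ℝ (Fin N)) : ℝ :=
  ∑ i : Fin N, fderiv ℝ V x (EuclideanSpace.single i 1) i

open Filter Topology InnerProductSpace

section Divergence

variable {N : ℕ}

theorem pdiv_smul {φ : EuclideanSpace ℝ (Fin N) → ℝ}
    {G : EuclideanSpace ℝ (Fin N) → EuclideanSpace ℝ (Fin N)} {x : EuclideanSpace ℝ (Fin N)}
    (hφ : DifferentiableAt ℝ φ x) (hG : DifferentiableAt ℝ G x) :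
    pdiv (fun y => φ y • G y) x = φ x * pdiv G x + fderiv ℝ φ x (G x) := by
  have hsum : G x = ∑ i, G x i • EuclideanSpace.single i (1 : ℝ) := by
    ext j
    simp [Finset.sum_apply, Pi.single_apply]
  conv_rhs => rw [hsum, map_sum]
  simp only [pdiv, fderiv_fun_smul hφ hG, Finset.mul_sum, ← Finset.sum_add_distrib]
  refine Finset.sum_congr rfl fun i _ => ?_
  simp [mul_comm]

theorem pdiv_sub {G H : EuclideanSpace ℝ (Fin N) → EuclideanSpace ℝ (Fin N)}
    {x : EuclideanSpace ℝ (Fin N)} (hG : DifferentiableAt ℝ G x) (hH : DifferentiableAt ℝ H x) :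
    pdiv (fun y => G y - H y) x = pdiv G x - pdiv H x := by
  simp [pdiv, fderiv_fun_sub hG hH]

theorem pdiv_congr {G H : EuclideanSpace ℝ (Fin N) → EuclideanSpace ℝ (Fin N)}
    {x : EuclideanSpace ℝ (Fin N)} (h : G =ᶠ[𝓝 x] H) : pdiv G x = pdiv H x := by
  simp [pdiv, h.fderiv_eq]

theorem continuous_pdiv {X : EuclideanSpace ℝ (Fin N) → EuclideanSpace ℝ (Fin N)}
    (hX : ContDiff ℝ 1 X) : Continuous (pdiv X) := by
  have := hX.continuous_fderiv one_ne_zero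
  unfold pdiv
  fun_prop

theorem pdiv_eq_sum_fderiv_apply {X : EuclideanSpace ℝ (Fin N) → EuclideanSpace ℝ (Fin N)}
    {x : EuclideanSpace ℝ (Fin N)} (hX : DifferentiableAt ℝ X x) :
    pdiv X x = ∑ i, fderiv ℝ (fun y => X y i) x (EuclideanSpace.single i 1) := by
  refine Finset.sum_congr rfl fun i _ => ?_
  have := ((EuclideanSpace.proj i : EuclideanSpace ℝ (Fin N) →L[ℝ] ℝ).hasFDerivAt.comp x
    hX.hasFDerivAt).fderiv
  rw [show (fun y => X y i) = ⇑(EuclideanSpace.proj i : EuclideanSpace ℝ (Fin N) →L[ℝ] ℝ) ∘ X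
    from rfl, this]
  simp

theorem hasCompactSupport_pdiv {X : EuclideanSpace ℝ (Fin N) → EuclideanSpace ℝ (Fin N)}
    (hc : HasCompactSupport X) : HasCompactSupport (pdiv X) := by
  refine (hc.fderiv (𝕜 := ℝ)).mono fun x hx hx' => hx ?_
  simp [pdiv, hx']

theorem integral_pdiv_eq_zero {X : EuclideanSpace ℝ (Fin N) → EuclideanSpace ℝ (Fin N)}
    (hX : ContDiff ℝ 1 X) (hc : HasCompactSupport X) : ∫ x, pdiv X x = 0 := by
  simp_rw [fun x => pdiv_eq_sum_fderiv_apply (hX.differentiable one_ne_zero x)]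
  have hXi (i : Fin N) : ContDiff ℝ 1 fun y => X y i := by fun_prop
  have hci (i : Fin N) : HasCompactSupport fun y => X y i :=
    hc.comp_left (g := fun v : EuclideanSpace ℝ (Fin N) => v i) rfl
  have hint (i : Fin N) : Integrable fun x =>
      fderiv ℝ (fun y => X y i) x (EuclideanSpace.single i 1) :=
    Continuous.integrable_of_hasCompactSupport
      (((hXi i).continuous_fderiv one_ne_zero).clm_apply continuous_const)
      ((hci i).fderiv_apply (𝕜 := ℝ) _)
  rw [integral_finsetSum _ fun i _ => hint i]
  refine Finset.sum_eq_zero fun i _ => ?_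
  have := integral_mul_fderiv_eq_neg_fderiv_mul_of_integrable (μ := volume) (𝕜 := ℝ)
    (f := fun _ => (1 : ℝ)) (g := fun y => X y i) (v := EuclideanSpace.single i 1)
    (by simp) (by simpa using hint i)
    (by simpa using (hXi i).continuous.integrable_of_hasCompactSupport (hci i))
    (fun _ _ => by fun_prop) (fun x _ => (hXi i).differentiable one_ne_zero x)
  simpa using this

/-- A weak maximum principle: if `h` is nonpositive off a compact subset of `Ω`, cannot increase
along `G`, and `G` has negative divergence off a point, then `h ≤ 0`. -/
theorem nonpos_of_pdiv_neg [NeZero N] {Ω K : Set (EuclideanSpace ℝ (Fin N))} (hΩ : IsOpen Ω)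
    (hK : IsCompact K) (hKΩ : K ⊆ Ω) {h : EuclideanSpace ℝ (Fin N) → ℝ}
    {G : EuclideanSpace ℝ (Fin N) → EuclideanSpace ℝ (Fin N)} (hh : ContDiffOn ℝ 1 h Ω)
    (hG : ContDiffOn ℝ 1 G Ω) (hhK : ∀ x ∈ Ω, x ∉ K → h x ≤ 0)
    (hhG : ∀ x ∈ Ω, fderiv ℝ h x (G x) ≤ 0) {x₀ : EuclideanSpace ℝ (Fin N)}
    (hdiv : ∀ x ∈ Ω, pdiv G x ≤ 0) (hdiv' : ∀ x ∈ Ω, x ≠ x₀ → pdiv G x < 0) :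
    ∀ x ∈ Ω, h x ≤ 0 := by
  set φ : EuclideanSpace ℝ (Fin N) → ℝ := Ω.indicator fun x => expNegInvGlue (h x) with hφ
  have hφΩ : ∀ x ∈ Ω, φ =ᶠ[𝓝 x] fun y => expNegInvGlue (h y) := fun x hx =>
    (hΩ.eventually_mem hx).mono fun y hy => indicator_of_mem hy _
  have hφK : ∀ x ∉ K, φ x = 0 := fun x hx => by
    by_cases hxΩ : x ∈ Ω
    · simpa [hφ, hxΩ] using hhK x hxΩ hx
    · simp [hφ, hxΩ]
  have hφ0 : ∀ x, 0 ≤ φ x := fun x => indicator_nonneg (fun _ _ => expNegInvGlue.nonneg _) x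
  have hφsupp : HasCompactSupport φ := HasCompactSupport.intro hK hφK
  have hφC (x) (hx : x ∈ Ω) : ContDiffAt ℝ 1 φ x :=
    ((expNegInvGlue.contDiff (n := 1)).contDiffAt.comp x
      (hh.contDiffAt (hΩ.mem_nhds hx))).congr_of_eventuallyEq (hφΩ x hx)
  have hGC (x) (hx : x ∈ Ω) : ContDiffAt ℝ 1 G x := hG.contDiffAt (hΩ.mem_nhds hx)
  set X : EuclideanSpace ℝ (Fin N) → EuclideanSpace ℝ (Fin N) := fun x => φ x • G x with hXdef
  have hXK : ∀ x ∉ K, X =ᶠ[𝓝 x] fun _ => 0 := fun x hx =>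
    (hK.isClosed.isOpen_compl.eventually_mem hx).mono fun y hy => by simp [hXdef, hφK y hy]
  have hX : ContDiff ℝ 1 X := by
    refine contDiff_iff_contDiffAt.2 fun x => ?_
    by_cases hx : x ∈ K
    · exact (hφC x (hKΩ hx)).smul (hGC x (hKΩ hx))
    · exact contDiffAt_const.congr_of_eventuallyEq (hXK x hx)
  have hXc : HasCompactSupport X := hφsupp.smul_right
  have hle : ∀ x ∈ Ω, pdiv X x ≤ φ x * pdiv G x := fun x hx => by
    rw [pdiv_smul ((hφC x hx).differentiableAt one_ne_zero)
      ((hGC x hx).differentiableAt one_ne_zero)]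
    have hd := ((expNegInvGlue.contDiff (n := 1)).differentiable one_ne_zero
      (h x)).hasDerivAt.comp_hasFDerivAt x
      ((hh.contDiffAt (hΩ.mem_nhds hx)).differentiableAt one_ne_zero).hasFDerivAt
    have hd' : fderiv ℝ φ x = deriv expNegInvGlue (h x) • fderiv ℝ h x :=
      (hd.congr_of_eventuallyEq (hφΩ x hx)).fderiv
    rw [hd']
    have := mul_nonpos_of_nonneg_of_nonpos (expNegInvGlue.monotone.deriv_nonneg (x := h x))
      (hhG x hx)
    simpa using this
  have hXneg : ∀ x, pdiv X x ≤ 0 := fun x => by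
    by_cases hx : x ∈ Ω
    · exact (hle x hx).trans (mul_nonpos_of_nonneg_of_nonpos (hφ0 x) (hdiv x hx))
    · rw [pdiv_congr (hXK x fun h => hx (hKΩ h))]
      simp [pdiv]
  have hX0 : pdiv X = 0 := by
    have hcont := continuous_pdiv hX
    have hi := hcont.integrable_of_hasCompactSupport (μ := volume) (hasCompactSupport_pdiv hXc)
    have h0 := (integral_eq_zero_iff_of_nonneg (f := fun x => -pdiv X x)
      (fun x => by simpa using hXneg x) hi.neg).1
      (by rw [integral_neg, integral_pdiv_eq_zero hX hXc, neg_zero])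
    have := (hcont.neg.ae_eq_iff_eq volume continuous_const).1 h0
    ext x
    exact neg_eq_zero.1 (congrFun this x)
  have hφne : ∀ x ∈ Ω, x ≠ x₀ → h x ≤ 0 := fun x hx hne => by
    by_contra! hpos
    have h1 : 0 < φ x := by
      simpa [hφ, hx] using expNegInvGlue.pos_of_pos hpos
    have h2 := hle x hx
    rw [hX0] at h2
    exact absurd h2 (not_le.2 (mul_neg_of_pos_of_neg h1 (hdiv' x hx hne)))
  intro x hx
  by_cases hne : x = x₀
  · subst hne
    have : Nontrivial (EuclideanSpace ℝ (Fin N)) := inferInstance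
    have : (𝓝[≠] x).NeBot := Module.punctured_nhds_neBot ℝ _ x
    refine le_of_tendsto ((hh.contDiffAt (hΩ.mem_nhds hx)).continuousAt.tendsto.mono_left
      (nhdsWithin_le_nhds (s := {x}ᶜ))) ?_
    filter_upwards [self_mem_nhdsWithin, nhdsWithin_le_nhds (hΩ.mem_nhds hx)] with y hy hyΩ
    exact hφne y hyΩ hy
  · exact hφne x hx hne

end Divergence

section NormRpow

variable {E : Type*} [NormedAddCommGroup E] [InnerProductSpace ℝ E]

theorem norm_rpow_smul_monotone {p : ℝ} (hp : 1 < p) (a b : E) :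
    0 ≤ ⟪‖a‖ ^ (p - 2) • a - ‖b‖ ^ (p - 2) • b, a - b⟫_ℝ := by
  have key (c : E) : ‖c‖ ^ (p - 2) * ‖c‖ = ‖c‖ ^ (p - 1) := by
    rcases (norm_nonneg c).eq_or_lt' with hc | hc
    · rw [hc, mul_zero, Real.zero_rpow (by linarith)]
    · rw [← Real.rpow_add_one hc.ne']; ring_nf
  have hab := real_inner_le_norm a b
  have ha : 0 ≤ ‖a‖ ^ (p - 2) := by positivity
  have hb : 0 ≤ ‖b‖ ^ (p - 2) := by positivity
  have hmono : 0 ≤ (‖a‖ ^ (p - 1) - ‖b‖ ^ (p - 1)) * (‖a‖ - ‖b‖) := by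
    rcases le_total ‖a‖ ‖b‖ with h | h
    · exact mul_nonneg_of_nonpos_of_nonpos
        (sub_nonpos.2 (Real.rpow_le_rpow (norm_nonneg _) h (by linarith))) (sub_nonpos.2 h)
    · exact mul_nonneg
        (sub_nonneg.2 (Real.rpow_le_rpow (norm_nonneg _) h (by linarith))) (sub_nonneg.2 h)
  rw [← key a, ← key b] at hmono
  simp only [inner_sub_left, inner_sub_right, real_inner_smul_left, real_inner_self_eq_norm_sq,
    real_inner_comm a b]
  nlinarith [mul_le_mul_of_nonneg_left hab ha, mul_le_mul_of_nonneg_left hab hb]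

theorem hasFDerivAt_norm_rpow_smul {α : ℝ} (hα : 0 < α) (x : E) :
    HasFDerivAt (fun x : E => ‖x‖ ^ α • x)
      (‖x‖ ^ α • ContinuousLinearMap.id ℝ E
        + ((α * ‖x‖ ^ (α - 2)) • innerSL ℝ x).smulRight x) x := by
  rcases eq_or_ne x 0 with rfl | hx
  · have h0 : Tendsto (fun x : E => ‖x‖ ^ α) (𝓝 0) (𝓝 0) := by
      have : Continuous fun x : E => ‖x‖ ^ α := continuous_norm.rpow_const fun _ => .inr hα.le
      simpa [Real.zero_rpow hα.ne'] using this.tendsto 0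
    simp only [norm_zero, Real.zero_rpow hα.ne', zero_smul, map_zero, smul_zero,
      ContinuousLinearMap.smulRight_zero, add_zero]
    refine .of_isLittleO ?_
    have h1 : (fun x : E => ‖x‖ ^ α • x) =o[𝓝 0] fun x : E => (1 : ℝ) • x :=
      ((Asymptotics.isLittleO_one_iff ℝ).2 h0).smul_isBigO (Asymptotics.isBigO_refl _ _)
    simpa [Real.zero_rpow hα.ne'] using h1
  · have hn : 0 < ‖x‖ := norm_pos_iff.2 hx
    have h1 : HasFDerivAt (fun x : E => ‖x‖ ^ α) ((α * ‖x‖ ^ (α - 2)) • innerSL ℝ x) x := by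
      have h2 := (hasStrictFDerivAt_norm_sq x).hasFDerivAt.rpow_const (p := α / 2)
        (.inl (by positivity))
      have h3 (y : E) : (‖y‖ ^ 2) ^ (α / 2) = ‖y‖ ^ α := by
        rw [← Real.rpow_natCast, ← Real.rpow_mul (norm_nonneg _)]; congr 1; push_cast; ring
      have h4 : (‖x‖ ^ 2) ^ (α / 2 - 1) = ‖x‖ ^ (α - 2) := by
        rw [← Real.rpow_natCast, ← Real.rpow_mul (norm_nonneg _)]; congr 1; push_cast; ring
      simp only [h3, h4] at h2
      convert h2 using 1
      ext v
      simp
      ring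
    exact h1.smul (hasFDerivAt_id x)

theorem contDiff_norm_rpow_smul {α : ℝ} (hα : 0 < α) :
    ContDiff ℝ 1 (fun x : E => ‖x‖ ^ α • x) := by
  have hcont : Continuous fun x : E => ‖x‖ ^ α := continuous_norm.rpow_const fun _ => .inr hα.le
  refine contDiff_one_iff_hasFDerivAt.2 ⟨_, ?_, hasFDerivAt_norm_rpow_smul hα⟩
  refine (hcont.smul continuous_const).add (continuous_iff_continuousAt.2 fun x => ?_)
  rcases eq_or_ne x 0 with rfl | hx
  · rw [ContinuousAt, ContinuousLinearMap.smulRight_zero]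
    refine squeeze_zero_norm (a := fun x : E => α * ‖x‖ ^ α) (fun x => ?_) ?_
    · rw [ContinuousLinearMap.norm_smulRight_apply, norm_smul, innerSL_apply_norm,
        Real.norm_of_nonneg (by positivity)]
      rcases eq_or_ne x 0 with rfl | hx
      · simp [Real.zero_rpow hα.ne']
      · have hn : 0 < ‖x‖ := norm_pos_iff.2 hx
        rw [mul_assoc, mul_assoc, ← mul_assoc (‖x‖ ^ (α - 2)), ← Real.rpow_add_one hn.ne',
          ← Real.rpow_add_one hn.ne']
        ring_nf
        rfl
    · simpa [Real.zero_rpow hα.ne'] using (hcont.const_mul α).tendsto 0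
  · have h1 : ContinuousAt (fun x : E => ‖x‖ ^ (α - 2)) x :=
      continuous_norm.continuousAt.rpow_const (.inl (norm_ne_zero_iff.2 hx))
    have h2 : ContinuousAt (fun x : E => (α * ‖x‖ ^ (α - 2)) • innerSL ℝ x) x :=
      (h1.const_mul α).smul (innerSL ℝ).continuous.continuousAt
    exact ((ContinuousLinearMap.smulRightL ℝ E E).continuous.continuousAt.comp h2).clm_apply
      continuousAt_id

end NormRpow

section RadialProfile

variable {N : ℕ}

theorem pdiv_norm_rpow_smul {α : ℝ} (hα : 0 < α) (x : EuclideanSpace ℝ (Fin N)) :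
    pdiv (fun x => ‖x‖ ^ α • x) x = (α + N) * ‖x‖ ^ α := by
  simp only [pdiv, (hasFDerivAt_norm_rpow_smul hα x).fderiv]
  have hsq : ∑ i, x i * x i = ‖x‖ ^ 2 := by
    rw [EuclideanSpace.real_norm_sq_eq]
    exact Finset.sum_congr rfl fun i _ => (sq _).symm
  have hα2 : ‖x‖ ^ (α - 2) * ‖x‖ ^ 2 = ‖x‖ ^ α := by
    rcases (norm_nonneg x).eq_or_lt' with hx | hx
    · simp [hx, Real.zero_rpow hα.ne']
    · rw [← Real.rpow_natCast, ← Real.rpow_add hx]; congr 1; push_cast; ring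
  have hi (i : Fin N) : (‖x‖ ^ α • ContinuousLinearMap.id ℝ (EuclideanSpace ℝ (Fin N))
        + ((α * ‖x‖ ^ (α - 2)) • innerSL ℝ x).smulRight x) (EuclideanSpace.single i 1) i =
      ‖x‖ ^ α + α * ‖x‖ ^ (α - 2) * (x i * x i) := by
    simp [EuclideanSpace.inner_single_right]
    ring
  simp only [hi, Finset.sum_add_distrib, ← Finset.mul_sum, hsq]
  simp [mul_assoc, hα2]
  ring

theorem flux_smul_gradient {p s : ℝ} (hs : 0 < s)
    {u w : EuclideanSpace ℝ (Fin N) → ℝ} {x : EuclideanSpace ℝ (Fin N)}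
    (h : gradient w x = s • gradient u x) : flux p w x = s ^ (p - 1) • flux p u x := by
  rw [flux, flux, h, norm_smul, Real.norm_of_nonneg hs.le,
    Real.mul_rpow hs.le (norm_nonneg _), smul_smul, smul_smul]
  congr 1
  rw [show p - 1 = p - 2 + 1 by ring, Real.rpow_add_one hs.ne']
  ring

theorem hasGradientAt_const_mul_sub_norm_rpow {β : ℝ} (hβ : 1 < β) (c d : ℝ)
    (x : EuclideanSpace ℝ (Fin N)) :
    HasGradientAt (fun x => c * (d - ‖x‖ ^ β)) (-(c * β * ‖x‖ ^ (β - 2)) • x) x := by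
  have h : toDual ℝ (EuclideanSpace ℝ (Fin N)) (-(c * β * ‖x‖ ^ (β - 2)) • x) =
      c • -((β * ‖x‖ ^ (β - 2)) • innerSL ℝ x) := by
    ext v
    simp
    ring
  rw [hasGradientAt_iff_hasFDerivAt, h]
  exact ((hasFDerivAt_norm_rpow x hβ).const_sub d).const_mul c

theorem flux_const_mul_sub_norm_rpow {p α c : ℝ} (hp : 1 < p) (hα : 0 < α) (hc : 0 < c) (d : ℝ)
    (x : EuclideanSpace ℝ (Fin N)) :
    flux p (fun x => c * (d - ‖x‖ ^ ((α + p) / (p - 1)))) x =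
      -((c * ((α + p) / (p - 1))) ^ (p - 1)) • (‖x‖ ^ α • x) := by
  have hp1 : 0 < p - 1 := by linarith
  have hβ : 1 < (α + p) / (p - 1) := by rw [lt_div_iff₀ hp1]; linarith
  rw [flux, (hasGradientAt_const_mul_sub_norm_rpow hβ c d x).gradient]
  set β := (α + p) / (p - 1) with hβdef
  rcases eq_or_ne x 0 with rfl | hx
  · simp
  have hn : 0 < ‖x‖ := norm_pos_iff.2 hx
  have hcβ : 0 < c * β := by positivity
  rw [norm_smul, norm_neg, Real.norm_of_nonneg (by positivity), smul_smul, smul_smul]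
  congr 1
  have h1 : ‖x‖ ^ α = (‖x‖ ^ (β - 1)) ^ (p - 2) * ‖x‖ ^ (β - 2) := by
    rw [← Real.rpow_mul hn.le, ← Real.rpow_add hn]
    congr 1
    have : β * (p - 1) = α + p := by rw [hβdef]; field_simp
    linarith
  rw [mul_assoc (c * β), ← Real.rpow_add_one hn.ne', show β - 2 + 1 = β - 1 by ring,
    Real.mul_rpow hcβ.le (by positivity), h1, show p - 1 = p - 2 + 1 by ring,
    Real.rpow_add_one hcβ.ne']
  ring

end RadialProfile

section Supersolution

variable {N : ℕ}

theorem pdiv_inv_comp_smul_flux_le {p : ℝ} {f : ℝ → ℝ} {u : EuclideanSpace ℝ (Fin N) → ℝ}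
    {x : EuclideanSpace ℝ (Fin N)} (hf : DifferentiableAt ℝ f (u x)) (hpos : 0 < f (u x))
    (hf' : 0 ≤ deriv f (u x)) (hu : DifferentiableAt ℝ u x)
    (hV : DifferentiableAt ℝ (flux p u) x) :
    pdiv (fun y => (f (u y))⁻¹ • flux p u y) x ≤ (f (u x))⁻¹ * pdiv (flux p u) x := by
  have hd := ((hf.hasDerivAt.inv hpos.ne').comp_hasFDerivAt x hu.hasFDerivAt)
  have huV : 0 ≤ fderiv ℝ u x (flux p u x) := by
    rw [flux, map_smul, ← toDual_gradient, toDual_apply_apply, real_inner_self_eq_norm_sq]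
    positivity
  have hd' : fderiv ℝ (fun y => (f (u y))⁻¹) x =
      (-deriv f (u x) / f (u x) ^ 2) • fderiv ℝ u x := hd.fderiv
  rw [pdiv_smul (φ := fun y => (f (u y))⁻¹) hd.differentiableAt hV, hd', neg_div]
  have : 0 ≤ deriv f (u x) / f (u x) ^ 2 * fderiv ℝ u x (flux p u x) := by positivity
  simpa using this

theorem exists_subcritical_profile {M R K lam β q : ℝ} (hM : 0 ≤ M) (hR : 0 < R) (hβ : 0 < β)
    (hq : 0 < q) (h : (β * M) ^ q * K * R ^ (-(β * q)) < lam) :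
    ∃ c r, 0 < c ∧ 0 < r ∧ r < R ∧ M < c * r ^ β ∧ (c * β) ^ q * K < lam := by
  have hRβ : 0 < R ^ β := by positivity
  have h0 : (M / R ^ β * β) ^ q * K < lam := by
    convert h using 1
    rw [show M / R ^ β * β = β * M * R ^ (-β) by rw [Real.rpow_neg hR.le]; ring,
      Real.mul_rpow (by positivity) (by positivity), ← Real.rpow_mul hR.le]
    ring_nf
  have hcont : Continuous fun c : ℝ => (c * β) ^ q * K :=
    ((continuous_id.mul continuous_const).rpow_const fun _ => .inr hq.le).mul continuous_const
  have hev := hcont.continuousAt.eventually_lt continuousAt_const h0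
  obtain ⟨c, hc, hMc⟩ := ((hev.filter_mono nhdsWithin_le_nhds).and
    (self_mem_nhdsWithin (s := Ioi (M / R ^ β)))).exists
  have hMc' : M < c * R ^ β := (div_lt_iff₀ hRβ).1 hMc
  have hcont' : Continuous fun r : ℝ => c * r ^ β :=
    continuous_const.mul (continuous_id.rpow_const fun _ => .inr hβ.le)
  have hev' := (continuousAt_const.eventually_lt hcont'.continuousAt hMc').and (lt_mem_nhds hR)
  obtain ⟨r, ⟨hr, hr0⟩, hrR⟩ := ((hev'.filter_mono nhdsWithin_le_nhds).and
    (self_mem_nhdsWithin (s := Iio R))).exists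
  exact ⟨c, r, (by positivity : 0 ≤ M / R ^ β).trans_lt hMc, hr0, hrR, hr, hc⟩

theorem hasDerivAt_integral_of_integrableOn_Ioo {g : ℝ → ℝ} {s : Set ℝ} (hs : IsOpen s)
    (hg : ContinuousOn g s) {t : ℝ} (ht : t ∈ s) (ht0 : 0 < t) (hint : IntegrableOn g (Ioo 0 t)) :
    HasDerivAt (fun t => ∫ x in (0 : ℝ)..t, g x) (g t) t :=
  intervalIntegral.integral_hasDerivAt_right
    ((intervalIntegrable_iff_integrableOn_Ioo_of_le ht0.le).2 hint)
    (hg.stronglyMeasurableAtFilter hs t ht) (hg.continuousAt (hs.mem_nhds ht))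

end Supersolution

/-- Theorem 4.1 (ii): nonexistence of positive `C¹` supersolutions of
`-Δ_p u ≥ λ ‖x‖^α f(u)` on the ball `B_R(0)`, vanishing on the sphere `‖x‖ = R`,
whenever `λ > (((α+p)/(p-1)) ‖F‖_∞)^(p-1) (α+N) R^(-(α+p))` with
`‖F‖_∞ = ∫₀^{a_f} f(s)^(-1/(p-1)) ds` (encoded as `sSup` of the range of `F`,
assumed bounded). -/
theorem stmt15 {N : ℕ} (hN : 1 ≤ N) (p : ℝ) (hp : 1 < p)
    (α : ℝ) (hα : 0 < α) (R : ℝ) (hR : 0 < R)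
    (af : EReal) (haf : 0 < af) (f : ℝ → ℝ)
    (hf0 : ∀ t : ℝ, 0 ≤ t → (t : EReal) < af → 0 ≤ f t)
    (hfpos : ∀ t : ℝ, 0 < t → (t : EReal) < af → 0 < f t)
    (hmono : MonotoneOn f {t : ℝ | 0 ≤ t ∧ (t : EReal) < af})
    (hreg : ContDiffOn ℝ 1 f {t : ℝ | 0 ≤ t ∧ (t : EReal) < af})
    (hint : ∀ a : ℝ, 0 < a → (a : EReal) < af →
      IntegrableOn (fun s => f s ^ (-(1 / (p - 1)))) (Ioo 0 a))
    (F : ℝ → ℝ) (hF : F = fun t => ∫ s in (0:ℝ)..t, f s ^ (-(1 / (p - 1))))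
    (hFbdd : BddAbove (F '' {t : ℝ | 0 ≤ t ∧ (t : EReal) < af}))
    (lam : ℝ)
    (hlam : (((α + p) / (p - 1)) *
        sSup (F '' {t : ℝ | 0 ≤ t ∧ (t : EReal) < af})) ^ (p - 1) *
        (α + (N : ℝ)) * R ^ (-(α + p)) < lam) :
    ¬ ∃ u : EuclideanSpace ℝ (Fin N) → ℝ,
        ContinuousOn u (closure (ball (0 : EuclideanSpace ℝ (Fin N)) R)) ∧
        ContDiffOn ℝ 1 u (ball (0 : EuclideanSpace ℝ (Fin N)) R) ∧
        (∀ x ∈ ball (0 : EuclideanSpace ℝ (Fin N)) R, 0 < u x ∧ ((u x : ℝ) : EReal) < af) ∧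
        (∀ x : EuclideanSpace ℝ (Fin N), ‖x‖ = R → u x = 0) ∧
        ContDiffOn ℝ 1 (flux p u) (ball (0 : EuclideanSpace ℝ (Fin N)) R) ∧
        ∀ x ∈ ball (0 : EuclideanSpace ℝ (Fin N)) R,
          pdiv (flux p u) x ≤ -(lam * ‖x‖ ^ α * f (u x)) := by
  rintro ⟨u, -, huC, hu, -, hV, hdiv⟩
  have : NeZero N := ⟨by omega⟩
  have hp1 : 0 < p - 1 := by linarith
  set β := (α + p) / (p - 1) with hβdef
  have hβ : 1 < β := by rw [hβdef, lt_div_iff₀ hp1]; linarith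
  set S := {t : ℝ | 0 ≤ t ∧ (t : EReal) < af}
  set M := sSup (F '' S)
  set I := {t : ℝ | 0 < t ∧ (t : EReal) < af}
  have hIS : I ⊆ S := fun t ht => ⟨ht.1.le, ht.2⟩
  have hIo : IsOpen I := isOpen_Ioi.inter (isOpen_Iio.preimage continuous_coe_real_ereal)
  have hFM : ∀ t ∈ S, F t ≤ M := fun t ht => le_csSup hFbdd (mem_image_of_mem F ht)
  have hF0 : ∀ t ∈ S, 0 ≤ F t := fun t ht => by
    rw [hF]
    exact intervalIntegral.integral_nonneg ht.1 fun s hs =>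
      Real.rpow_nonneg (hf0 s hs.1 ((EReal.coe_le_coe_iff.2 hs.2).trans_lt ht.2)) _
  have hM : 0 ≤ M := by
    have h0 : (0 : ℝ) ∈ S := ⟨le_rfl, by simpa using haf⟩
    exact (hF0 0 h0).trans (hFM 0 h0)
  obtain ⟨c, r, hc, hr, hrR, hMc, hclam⟩ :=
    exists_subcritical_profile (β := β) (q := p - 1) (K := α + N) hM hR (by linarith) hp1
      (by rwa [show β * (p - 1) = α + p by rw [hβdef]; field_simp])
  have hfI : ContDiffOn ℝ 1 f I := hreg.mono hIS
  have hfd : ∀ t ∈ I, DifferentiableAt ℝ f t := fun t ht =>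
    (hfI.contDiffAt (hIo.mem_nhds ht)).differentiableAt one_ne_zero
  have hf' : ∀ t ∈ I, 0 ≤ deriv f t := fun t ht => by
    rw [← derivWithin_of_isOpen hIo ht]
    exact (hmono.mono hIS).derivWithin_nonneg
  have hgc : ContinuousOn (fun s => f s ^ (-(1 / (p - 1)))) I :=
    hfI.continuousOn.rpow_const fun t ht => .inl (hfpos t ht.1 ht.2).ne'
  have hFd : ∀ t ∈ I, HasDerivAt F (f t ^ (-(1 / (p - 1)))) t := fun t ht => by
    rw [hF]
    exact hasDerivAt_integral_of_integrableOn_Ioo hIo hgc ht ht.1 (hint t ht.1 ht.2)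
  have hFC : ContDiffOn ℝ 1 F I := by
    rw [show (1 : WithTop ℕ∞) = 0 + 1 by simp, contDiffOn_succ_iff_deriv_of_isOpen hIo,
      contDiffOn_zero]
    exact ⟨fun t ht => (hFd t ht).differentiableAt.differentiableWithinAt, by simp,
      hgc.congr fun t ht => (hFd t ht).deriv⟩
  set Ω := ball (0 : EuclideanSpace ℝ (Fin N)) R with hΩ
  have huI : MapsTo u Ω I := hu
  have hud : ∀ x ∈ Ω, DifferentiableAt ℝ u x := fun x hx =>
    (huC.contDiffAt (isOpen_ball.mem_nhds hx)).differentiableAt one_ne_zero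
  have hVd : ∀ x ∈ Ω, DifferentiableAt ℝ (flux p u) x := fun x hx =>
    (hV.contDiffAt (isOpen_ball.mem_nhds hx)).differentiableAt one_ne_zero
  have hfu : ∀ x ∈ Ω, 0 < f (u x) := fun x hx => hfpos _ (hu x hx).1 (hu x hx).2
  have hwgrad : ∀ x ∈ Ω, HasGradientAt (fun x => F (u x))
      (f (u x) ^ (-(1 / (p - 1))) • gradient u x) x := fun x hx => by
    rw [hasGradientAt_iff_hasFDerivAt, map_smul, toDual_gradient]
    exact (hFd _ (huI hx)).comp_hasFDerivAt x (hud x hx).hasFDerivAt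
  have hwflux : ∀ x ∈ Ω, flux p (fun x => F (u x)) x = (f (u x))⁻¹ • flux p u x :=
    fun x hx => by
      rw [flux_smul_gradient (Real.rpow_pos_of_pos (hfu x hx) _) (hwgrad x hx).gradient,
        ← Real.rpow_mul (hfu x hx).le, show -(1 / (p - 1)) * (p - 1) = -1 by field_simp,
        Real.rpow_neg_one]
  set K := (c * β) ^ (p - 1) with hK
  set ψ : EuclideanSpace ℝ (Fin N) → ℝ := fun x => c * (r ^ β - ‖x‖ ^ β) with hψ
  have hψflux (x) : flux p ψ x = -K • (‖x‖ ^ α • x) :=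
    flux_const_mul_sub_norm_rpow hp hα hc _ x
  have hψgrad (x : EuclideanSpace ℝ (Fin N)) := hasGradientAt_const_mul_sub_norm_rpow hβ c (r ^ β) x
  have hWC : ContDiffOn ℝ 1 (fun x => (f (u x))⁻¹ • flux p u x) Ω :=
    ((hfI.comp huC huI).inv fun x hx => (hfu x hx).ne').smul hV
  have hPC : ContDiff ℝ 1 fun x : EuclideanSpace ℝ (Fin N) => -K • (‖x‖ ^ α • x) :=
    (contDiff_norm_rpow_smul hα).const_smul _
  have hdivG : ∀ x ∈ Ω, pdiv (fun x => (f (u x))⁻¹ • flux p u x - -K • (‖x‖ ^ α • x)) x ≤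
      -((lam - K * (α + N)) * ‖x‖ ^ α) := fun x hx => by
    have hd : DifferentiableAt ℝ (fun x : EuclideanSpace ℝ (Fin N) => ‖x‖ ^ α • x) x :=
      (hasFDerivAt_norm_rpow_smul hα x).differentiableAt
    rw [pdiv_sub ((hWC.contDiffAt (isOpen_ball.mem_nhds hx)).differentiableAt one_ne_zero)
      (hPC.differentiable one_ne_zero x),
      pdiv_smul (φ := fun _ => -K) (differentiableAt_const _) hd, pdiv_norm_rpow_smul hα]
    have h1 := pdiv_inv_comp_smul_flux_le (hfd _ (huI hx)) (hfu x hx) (hf' _ (huI hx))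
      (hud x hx) (hVd x hx)
    have h2 := mul_le_mul_of_nonneg_left (hdiv x hx) (inv_pos.2 (hfu x hx)).le
    have h3 : (f (u x))⁻¹ * -(lam * ‖x‖ ^ α * f (u x)) = -(lam * ‖x‖ ^ α) := by
      have := (hfu x hx).ne'
      field_simp
    simp only [fderiv_fun_const, Pi.zero_apply, zero_apply, add_zero]
    nlinarith
  have hmain := nonpos_of_pdiv_neg (Ω := Ω) (K := closedBall 0 r) isOpen_ball
    (isCompact_closedBall _ _) (closedBall_subset_ball hrR) (x₀ := 0)
    (h := fun x => ψ x - F (u x))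
    (G := fun x => (f (u x))⁻¹ • flux p u x - -K • (‖x‖ ^ α • x))
    ((contDiff_const.mul (contDiff_const.sub (contDiff_norm_rpow hβ))).contDiffOn.sub
      (hFC.comp huC huI))
    (hWC.sub hPC.contDiffOn)
    (fun x hx hxr => by
      have h1 : r ^ β ≤ ‖x‖ ^ β :=
        Real.rpow_le_rpow hr.le (by simpa using hxr : r < ‖x‖).le (by linarith)
      have h2 := hF0 _ (hIS (huI hx))
      have h3 : ψ x ≤ 0 := mul_nonpos_of_nonneg_of_nonpos hc.le (by linarith)
      linarith)
    (fun x hx => by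
      have hd := ((hψgrad x).hasFDerivAt.sub (hwgrad x hx).hasFDerivAt).fderiv
      rw [← map_sub, ← (hψgrad x).gradient, ← (hwgrad x hx).gradient] at hd
      have hmon := norm_rpow_smul_monotone hp (gradient ψ x) (gradient (fun x => F (u x)) x)
      have h1 : fderiv ℝ (fun x => ψ x - F (u x)) x =
        toDual ℝ _ (gradient ψ x - gradient (fun x => F (u x)) x) := hd
      rw [h1, toDual_apply_apply, ← hwflux x hx, ← hψflux x, real_inner_comm,
        ← neg_sub (flux p ψ x), inner_neg_left]
      exact neg_nonpos.2 hmon)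
    (fun x hx => (hdivG x hx).trans (neg_nonpos.2
      (mul_nonneg (by linarith) (Real.rpow_nonneg (norm_nonneg _) _))))
    (fun x hx hx0 => (hdivG x hx).trans_lt (neg_lt_zero.2
      (mul_pos (by linarith) (Real.rpow_pos_of_pos (norm_pos_iff.2 hx0) _))))
  have h0Ω : (0 : EuclideanSpace ℝ (Fin N)) ∈ Ω := mem_ball_self hR
  have h0 := hmain 0 h0Ω
  have h1 := hFM _ (hIS (huI h0Ω))
  simp only [hψ, norm_zero, Real.zero_rpow (by linarith : β ≠ 0), sub_zero] at h0
  linarith
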